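/- Let X be a real 2n×2n matrix such that the matrix Y = -Xᵀ·J·X·J has no zero and no positive real eigenvalues (i.e. no real number t ≥ 0 lies in the spectrum of Y). Then there exists a real skew-Hamiltonian matrix M (i.e. (J·M)ᵀ = -J·M) and a real symplectic matrix S (S·J·Sᵀ = J) such that X = S·D·M, where D is the block diagonal matrix D = [[Iₙ, 0], [0, -Iₙ]]. -/

import Mathlib

open Matrix

/-- The standard symplectic form matrix `J = [[0, -I_n], [I_n, 0]]`. -/
def symplJ (n : ℕ) : Matrix (Fin n ⊕ Fin n) (Fin n ⊕ Fin n) ℝ :=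
  Matrix.fromBlocks 0 (-1) 1 0

/-- The block diagonal matrix `D = [[I_n, 0], [0, -I_n]]`. -/
def Dmat (n : ℕ) : Matrix (Fin n ⊕ Fin n) (Fin n ⊕ Fin n) ℝ :=
  Matrix.fromBlocks 1 0 0 (-1)

open Polynomial in
/-- Every complex number off the closed negative real axis has a square root that is a real
polynomial expression in it. -/
lemma exists_aeval_sq_eq (z : ℂ) (hz : ∀ t : ℝ, t ≤ 0 → z ≠ t) :
    ∃ q : ℝ[X], aeval z q ^ 2 = z := by
  by_cases him : z.im = 0
  · have hzre : z = (z.re : ℂ) := Complex.ext rfl (by simpa using him)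
    have hpos : 0 ≤ z.re := by
      by_contra! h
      exact hz z.re h.le hzre
    refine ⟨C √z.re, ?_⟩
    rw [aeval_C, Complex.coe_algebraMap, ← Complex.ofReal_pow, Real.sq_sqrt hpos, ← hzre]
  · obtain ⟨w, hw⟩ := IsAlgClosed.exists_pow_nat_eq z two_pos
    refine ⟨C (w.re - w.im / z.im * z.re) + C (w.im / z.im) * X, ?_⟩
    have haeval : aeval z (C (w.re - w.im / z.im * z.re) + C (w.im / z.im) * X) = w := by
      rw [map_add, map_mul, aeval_C, aeval_C, aeval_X]
      apply Complex.ext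
      · simp
      · simp [him]
    rw [haeval, hw]

open Polynomial in
/-- `X` is a square modulo an irreducible real polynomial without roots in `(-∞, 0]`. -/
lemma Irreducible.exists_dvd_sq_sub_X {p : ℝ[X]} (hp : Irreducible p)
    (hroot : ∀ t : ℝ, t ≤ 0 → ¬ p.IsRoot t) : ∃ q : ℝ[X], p ∣ q ^ 2 - X := by
  obtain ⟨z, hz⟩ := IsAlgClosed.exists_aeval_eq_zero ℂ p hp.degree_pos.ne'
  obtain ⟨q, hq⟩ := exists_aeval_sq_eq z fun t ht hzt ↦ hroot t ht <| by
    rw [hzt, ← Complex.coe_algebraMap, aeval_algebraMap_apply, Complex.coe_algebraMap,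
      Complex.ofReal_eq_zero] at hz
    simpa using hz
  have hmin : Associated (minpoly ℝ z) p :=
    (minpoly.irreducible (Algebra.IsIntegral.isIntegral z)).associated_of_dvd hp
      (minpoly.dvd ℝ z hz)
  exact ⟨q, hmin.symm.dvd.trans (minpoly.dvd ℝ z (by simp [hq]))⟩

open Polynomial in
/-- `X` is a square modulo each power of an irreducible real polynomial without roots in
`(-∞, 0]`. -/
lemma Irreducible.exists_pow_dvd_sq_sub_X {p : ℝ[X]} (hp : Irreducible p)
    (hroot : ∀ t : ℝ, t ≤ 0 → ¬ p.IsRoot t) (k : ℕ) : ∃ q : ℝ[X], p ^ (k + 1) ∣ q ^ 2 - X := by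
  induction k with
  | zero => simpa using hp.exists_dvd_sq_sub_X hroot
  | succ k ih =>
    obtain ⟨q, hq⟩ := ih
    have hpX : ¬ p ∣ X := fun h ↦ hroot 0 le_rfl <| by
      have hassoc := hp.associated_of_dvd irreducible_X h
      have hX : (X : ℝ[X]).IsRoot 0 := by simp
      exact hX.dvd hassoc.symm.dvd
    have hpq : ¬ p ∣ q := fun h ↦ hpX <| by
      have := dvd_sub (dvd_pow h two_ne_zero) ((dvd_pow_self p k.succ_ne_zero).trans hq)
      simpa using this
    obtain ⟨a, b, hab⟩ := (hp.coprime_iff_not_dvd).2 hpq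
    obtain ⟨r, hr⟩ := hq
    have hhalf : (C (1 / 2 : ℝ)) * 2 = (1 : ℝ[X]) := by
      rw [← C_ofNat, ← C_mul]; norm_num
    refine ⟨q - C (1 / 2) * b * (q ^ 2 - X), r * a + C (1 / 2) ^ 2 * b ^ 2 * p ^ k * r ^ 2, ?_⟩
    have hexp : (q - C (1 / 2) * b * (q ^ 2 - X)) ^ 2 - X =
        (q ^ 2 - X) * (1 - (C (1 / 2) * 2) * (b * q))
          + C (1 / 2) ^ 2 * b ^ 2 * (q ^ 2 - X) ^ 2 := by ring
    have hpa : 1 - b * q = a * p := by rw [← hab]; ring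
    rw [hexp, hhalf, one_mul, hpa, hr]
    ring

open Polynomial in
/-- `X` is a square modulo a real polynomial without roots in `(-∞, 0]`. -/
lemma Polynomial.exists_dvd_sq_sub_X (f : ℝ[X]) (hroot : ∀ t : ℝ, t ≤ 0 → ¬ f.IsRoot t) :
    ∃ q : ℝ[X], f ∣ q ^ 2 - X := by
  induction f using UniqueFactorizationMonoid.induction_on_coprime with
  | h0 => exact absurd (by simp) (hroot 0 le_rfl)
  | h1 hu => exact ⟨0, hu.dvd⟩
  | hpr k hp =>
    obtain - | k := k
    · exact ⟨0, by simp⟩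
    · exact hp.irreducible.exists_pow_dvd_sq_sub_X
        (fun t ht h ↦ hroot t ht (h.dvd (dvd_pow_self _ k.succ_ne_zero))) k
  | @hcp f g hfg hf hg =>
    obtain ⟨q, hq⟩ := hf fun t ht h ↦ hroot t ht (h.dvd (dvd_mul_right f g))
    obtain ⟨r, hr⟩ := hg fun t ht h ↦ hroot t ht (h.dvd (dvd_mul_left g f))
    have hcop : IsCoprime f g := hfg.isCoprime
    have ⟨a, b, hab⟩ := hcop
    refine ⟨r * (a * f) + q * (b * g), hcop.mul_dvd ?_ ?_⟩
    · have h : (r * (a * f) + q * (b * g)) ^ 2 - X =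
          (q ^ 2 - X) + f * (a * (r - q) * (2 * q + (r - q) * (a * f))) := by
        rw [eq_sub_of_add_eq' hab]; ring
      rw [h]
      exact dvd_add hq (dvd_mul_right _ _)
    · have h : (r * (a * f) + q * (b * g)) ^ 2 - X =
          (r ^ 2 - X) + g * (b * (q - r) * (2 * r + (q - r) * (b * g))) := by
        rw [eq_sub_of_add_eq hab]; ring
      rw [h]
      exact dvd_add hr (dvd_mul_right _ _)

open Polynomial in
/-- A real square matrix without eigenvalues in `(-∞, 0]` has a square root that is a polynomial
in it. -/
lemma Matrix.exists_aeval_sq_eq {m : Type*} [Fintype m] [DecidableEq m] (A : Matrix m m ℝ)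
    (hA : ∀ t : ℝ, t ≤ 0 → t ∉ spectrum ℝ A) : ∃ q : ℝ[X], aeval A q ^ 2 = A := by
  obtain ⟨q, hq⟩ := A.charpoly.exists_dvd_sq_sub_X fun t ht h ↦
    hA t ht (Matrix.mem_spectrum_iff_isRoot_charpoly.2 h)
  refine ⟨q, sub_eq_zero.1 ?_⟩
  simpa using aeval_eq_zero_of_dvd_aeval_eq_zero hq A.aeval_self_charpoly

open Polynomial in
/-- An intertwining relation `A * B = B * Aᵀ` extends to polynomials in `A`. -/
lemma Matrix.aeval_mul_eq_mul_transpose_aeval {R m : Type*} [CommRing R] [Fintype m]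
    [DecidableEq m] {A B : Matrix m m R} (h : A * B = B * Aᵀ) (q : R[X]) :
    aeval A q * B = B * (aeval A q)ᵀ := by
  have hpow (k : ℕ) : A ^ k * B = B * (A ^ k)ᵀ := by
    rw [transpose_pow]
    exact ((show SemiconjBy B Aᵀ A from h.symm).pow_right k).symm
  induction q using Polynomial.induction_on' with
  | add p q hp hq => simp only [map_add, add_mul, transpose_add, mul_add, hp, hq]
  | monomial k a =>
    rw [aeval_monomial, ← Algebra.smul_def, smul_mul, transpose_smul, Matrix.mul_smul, hpow]

lemma Dmat_transpose (n : ℕ) : (Dmat n)ᵀ = Dmat n := by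
  simp [Dmat, fromBlocks_transpose]

lemma Dmat_mul_self (n : ℕ) : Dmat n * Dmat n = 1 := by
  simp [Dmat, fromBlocks_multiply]

lemma Dmat_mul_symplJ_mul_Dmat (n : ℕ) : Dmat n * symplJ n * Dmat n = -symplJ n := by
  simp [Dmat, symplJ, fromBlocks_multiply, fromBlocks_neg]

lemma symplJ_transpose (n : ℕ) : (symplJ n)ᵀ = -symplJ n :=
  J_transpose (Fin n) ℝ

lemma symplJ_mul_self (n : ℕ) : symplJ n * symplJ n = -1 :=
  J_squared (Fin n) ℝ

/-- Corollary: if `Y = -X^T*J*X*J` has no real eigenvalue `t ≥ 0`, then `X = S * D * M` with `M` skew-Hamiltonian and `S` symplectic. -/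
theorem stmt_11 (n : ℕ) (X : Matrix (Fin n ⊕ Fin n) (Fin n ⊕ Fin n) ℝ)
    (hY : ∀ t : ℝ, t ≥ 0 → t ∉ spectrum ℝ (-(Xᵀ * symplJ n * X * symplJ n))) :
    ∃ M S : Matrix (Fin n ⊕ Fin n) (Fin n ⊕ Fin n) ℝ,
      (symplJ n * M)ᵀ = -(symplJ n * M) ∧
      S * symplJ n * Sᵀ = symplJ n ∧ X = S * Dmat n * M := by
  set J := symplJ n
  have hJT : Jᵀ = -J := symplJ_transpose n
  have hJJ : J * J = -1 := symplJ_mul_self n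
  set A := Xᵀ * J * X * J with hA
  have hspec (t : ℝ) (ht : t ≤ 0) : t ∉ spectrum ℝ A := fun h ↦
    hY (-t) (by linarith) (by rw [← spectrum.neg_eq]; simpa using h)
  obtain ⟨q, hq⟩ := A.exists_aeval_sq_eq hspec
  have hAJ : A * J = -(Xᵀ * J * X) := by
    rw [hA, mul_assoc, hJJ, mul_neg, mul_one]
  have hAT : A * J = J * Aᵀ := by
    rw [hAJ, hA]
    simp only [transpose_mul, transpose_transpose, hJT, neg_mul, mul_neg, neg_neg, ← mul_assoc,
      hJJ, one_mul]
  have hBJ := aeval_mul_eq_mul_transpose_aeval hAT q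
  set B := Polynomial.aeval A q
  have hBunit : IsUnit B := by
    have : IsUnit A := spectrum.zero_notMem_iff ℝ |>.1 (hspec 0 le_rfl)
    rw [← hq] at this
    exact (isUnit_pow_iff two_ne_zero).1 this
  have hBdet : IsUnit B.det := (isUnit_iff_isUnit_det B).1 hBunit
  have hMdet : IsUnit Bᵀ.det := by rwa [det_transpose]
  refine ⟨Bᵀ, X * (Bᵀ)⁻¹ * Dmat n, ?_, ?_, ?_⟩
  · rw [← hBJ, transpose_mul, hJT, neg_mul, hBJ]
  · refine (SymplecticGroup.mem_iff (l := Fin n)).1 (SymplecticGroup.mem_iff'.2 ?_)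
    change (X * (Bᵀ)⁻¹ * Dmat n)ᵀ * J * (X * (Bᵀ)⁻¹ * Dmat n) = J
    have hXJX : Xᵀ * J * X = -(B * J * Bᵀ) := by
      rw [mul_assoc B, ← hBJ, ← mul_assoc B, ← sq, hq, hAJ, neg_neg]
    calc (X * (Bᵀ)⁻¹ * Dmat n)ᵀ * J * (X * (Bᵀ)⁻¹ * Dmat n)
        = Dmat n * (B⁻¹ * (Xᵀ * J * X) * (Bᵀ)⁻¹) * Dmat n := by
          simp only [transpose_mul, transpose_nonsing_inv, transpose_transpose, Dmat_transpose,
            mul_assoc]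
      _ = -(Dmat n * ((B⁻¹ * B) * J * (Bᵀ * (Bᵀ)⁻¹)) * Dmat n) := by
          rw [hXJX]
          simp only [mul_assoc, mul_neg, neg_mul]
      _ = J := by
          rw [nonsing_inv_mul _ hBdet, mul_nonsing_inv _ hMdet, one_mul, mul_one,
            Dmat_mul_symplJ_mul_Dmat, neg_neg]
  · rw [mul_assoc _ (Dmat n) (Dmat n), Dmat_mul_self, mul_one, mul_assoc,
      nonsing_inv_mul _ hMdet, mul_one]
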